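/- Let m, n ≥ 2 be relatively prime integers and let s ≥ 2 be relatively prime to both m and n. Then the S-adic odometer with S = (s, mn, mn, …) is topologically conjugate to the product of the S'-adic odometer with S' = (s, m, m, …) and the n-adic odometer, i.e. (Z̃(s,mn,mn,…), +1̃) is topologically conjugate to (Z̃(s,m,m,…) × Z̃(n,n,…), +1̃ × +1̃). -/

import Mathlib

instance (n : ℕ) : TopologicalSpace (ZMod n) := ⊥
instance (n : ℕ) : DiscreteTopology (ZMod n) := ⟨rfl⟩

/-- `odProd S k = s₁ s₂ ⋯ s_{k+1}` (where `S i = s_{i+1}`, i.e. `S 0 = s₁`). -/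
def odProd (S : ℕ → ℕ) (k : ℕ) : ℕ := ∏ i ∈ Finset.range (k + 1), S i

theorem odProd_dvd (S : ℕ → ℕ) (k : ℕ) : odProd S k ∣ odProd S (k + 1) := by
  have h : odProd S (k + 1) = odProd S k * S (k + 1) := Finset.prod_range_succ S (k + 1)
  rw [h]
  exact dvd_mul_right _ _

/-- `Z̃(S)`: the inverse limit of the cyclic groups `ℤ/(s₁⋯s_k)ℤ` under the
binding maps `z ↦ z mod s₁⋯s_k`, with its profinite (subspace-of-product)
topology. -/
def OdometerSpace (S : ℕ → ℕ) : Type :=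
  { z : (k : ℕ) → ZMod (odProd S k) //
      ∀ k, ZMod.castHom (odProd_dvd S k) (ZMod (odProd S k)) (z (k + 1)) = z k }

instance (S : ℕ → ℕ) : TopologicalSpace (OdometerSpace S) :=
  inferInstanceAs (TopologicalSpace
    { z : (k : ℕ) → ZMod (odProd S k) //
        ∀ k, ZMod.castHom (odProd_dvd S k) (ZMod (odProd S k)) (z (k + 1)) = z k })

/-- The `+1̃` map on the odometer: add `1` in every coordinate. -/
def odometerAddOne (S : ℕ → ℕ) (z : OdometerSpace S) : OdometerSpace S :=
  ⟨fun k => z.1 k + 1, fun k => by rw [map_add, map_one, z.2 k]⟩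

theorem OdometerSpace.continuous_coord (S : ℕ → ℕ) (k : ℕ) :
    Continuous fun z : OdometerSpace S => z.1 k :=
  (continuous_apply k).comp continuous_subtype_val

theorem OdometerSpace.continuous_of_coord {X : Type*} [TopologicalSpace X] {S : ℕ → ℕ}
    {f : X → OdometerSpace S} (hf : ∀ k, Continuous fun x => (f x).1 k) : Continuous f :=
  Continuous.subtype_mk (continuous_pi hf) fun x => (f x).2

/-- The projection between odometers whose moduli divide each other up to a shift of index. -/
def OdometerSpace.map {R S : ℕ → ℕ} (h : ∀ k, odProd S k ∣ odProd R (k + 1))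
    (z : OdometerSpace R) : OdometerSpace S :=
  ⟨fun k => ZMod.castHom (h k) (ZMod (odProd S k)) (z.1 (k + 1)), fun k => by
    obtain ⟨a, ha⟩ := ZMod.intCast_surjective (z.1 (k + 1 + 1))
    have h' := z.2 (k + 1)
    rw [← ha] at h'
    beta_reduce
    rw [← h', ← ha]
    simp only [map_intCast]⟩

theorem OdometerSpace.continuous_map {R S : ℕ → ℕ} (h : ∀ k, odProd S k ∣ odProd R (k + 1)) :
    Continuous (OdometerSpace.map h) :=
  continuous_of_coord fun k => continuous_of_discreteTopology.comp (continuous_coord R (k + 1))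

theorem OdometerSpace.map_odometerAddOne {R S : ℕ → ℕ}
    (h : ∀ k, odProd S k ∣ odProd R (k + 1)) (z : OdometerSpace R) :
    OdometerSpace.map h (odometerAddOne R z) = odometerAddOne S (OdometerSpace.map h z) :=
  Subtype.ext <| funext fun k => by simp only [map, odometerAddOne, map_add, map_one]

/-- Gluing compatible residues along the Chinese remainder theorem. -/
def OdometerSpace.glue {R S T : ℕ → ℕ} (hc : ∀ k, Nat.Coprime (odProd S k) (odProd T k))
    (h : ∀ k, odProd R k ∣ odProd S k * odProd T k)
    (p : OdometerSpace S × OdometerSpace T) : OdometerSpace R :=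
  ⟨fun k => ZMod.castHom (h k) (ZMod (odProd R k))
      ((ZMod.chineseRemainder (hc k)).symm (p.1.1 k, p.2.1 k)), fun k => by
    obtain ⟨a, ha⟩ := ZMod.intCast_surjective
      ((ZMod.chineseRemainder (hc (k + 1))).symm (p.1.1 (k + 1), p.2.1 (k + 1)))
    have hk : (p.1.1 k, p.2.1 k) = ZMod.chineseRemainder (hc k) (a : ZMod _) := by
      have h' := (RingEquiv.symm_apply_eq _).1 ha.symm
      rw [map_intCast] at h' ⊢
      have h₁ := congrArg Prod.fst h'
      have h₂ := congrArg Prod.snd h'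
      simp only [Prod.fst_intCast, Prod.snd_intCast] at h₁ h₂
      rw [← p.1.2 k, ← p.2.2 k, h₁, h₂, map_intCast, map_intCast]
      rfl
    beta_reduce
    rw [← ha, hk, RingEquiv.symm_apply_apply]
    simp only [map_intCast]⟩

theorem OdometerSpace.continuous_glue {R S T : ℕ → ℕ}
    (hc : ∀ k, Nat.Coprime (odProd S k) (odProd T k))
    (h : ∀ k, odProd R k ∣ odProd S k * odProd T k) :
    Continuous (OdometerSpace.glue (R := R) hc h) :=
  continuous_of_coord fun k =>
    (continuous_of_discreteTopology (f := fun q : ZMod (odProd S k) × ZMod (odProd T k) =>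
      ZMod.castHom (h k) (ZMod (odProd R k)) ((ZMod.chineseRemainder (hc k)).symm q))).comp
      (((continuous_coord S k).comp continuous_fst).prodMk
        ((continuous_coord T k).comp continuous_snd))

/-- An odometer splits as a product of two odometers with coprime moduli, provided the
two systems of moduli are cofinal. -/
def OdometerSpace.prodHomeomorph {R S T : ℕ → ℕ}
    (hc : ∀ k, Nat.Coprime (odProd S k) (odProd T k))
    (h : ∀ k, odProd R k ∣ odProd S k * odProd T k)
    (hS : ∀ k, odProd S k ∣ odProd R (k + 1)) (hT : ∀ k, odProd T k ∣ odProd R (k + 1)) :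
    OdometerSpace R ≃ₜ OdometerSpace S × OdometerSpace T where
  toFun z := (OdometerSpace.map hS z, OdometerSpace.map hT z)
  invFun := OdometerSpace.glue hc h
  left_inv z := Subtype.ext <| funext fun k => by
    obtain ⟨a, ha⟩ := ZMod.intCast_surjective (z.1 (k + 1))
    have hk : (ZMod.castHom (hS k) (ZMod (odProd S k)) (z.1 (k + 1)),
        ZMod.castHom (hT k) (ZMod (odProd T k)) (z.1 (k + 1))) =
        ZMod.chineseRemainder (hc k) (a : ZMod _) := by
      rw [← ha]
      simp only [map_intCast]
      rfl
    simp only [glue, map]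
    rw [hk, RingEquiv.symm_apply_apply, ← z.2 k, ← ha]
    simp only [map_intCast]
  right_inv p := by
    have key : ∀ k, ∃ a : ℤ, (glue hc h p).1 (k + 1) = (a : ZMod (odProd R (k + 1))) ∧
        p.1.1 k = a ∧ p.2.1 k = a := fun k => by
      obtain ⟨a, ha⟩ := ZMod.intCast_surjective
        ((ZMod.chineseRemainder (hc (k + 1))).symm (p.1.1 (k + 1), p.2.1 (k + 1)))
      have h' := (RingEquiv.symm_apply_eq _).1 ha.symm
      rw [map_intCast] at h'
      have h₁ := congrArg Prod.fst h'
      have h₂ := congrArg Prod.snd h'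
      simp only [Prod.fst_intCast, Prod.snd_intCast] at h₁ h₂
      refine ⟨a, ?_, ?_, ?_⟩
      · simp only [glue]
        rw [← ha, map_intCast]
      · rw [← p.1.2 k, h₁, map_intCast]
      · rw [← p.2.2 k, h₂, map_intCast]
    refine Prod.ext (Subtype.ext <| funext fun k => ?_) (Subtype.ext <| funext fun k => ?_)
    all_goals
      obtain ⟨a, ha, h₁, h₂⟩ := key k
      simp only [map, ha, h₁, h₂, map_intCast]
  continuous_toFun := (continuous_map hS).prodMk (continuous_map hT)
  continuous_invFun := continuous_glue hc h

theorem odProd_ite_zero (s a k : ℕ) :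
    odProd (fun i => if i = 0 then s else a) k = s * a ^ k := by
  simp [odProd, Finset.prod_range_succ', mul_comm]

theorem odProd_const (n k : ℕ) : odProd (fun _ => n) k = n ^ (k + 1) := by
  simp [odProd]

/-- For `m, n ≥ 2` relatively prime and `s ≥ 2` relatively prime to both `m`
and `n`, the `(s, mn, mn, …)`-adic odometer is topologically conjugate to the
product of the `(s, m, m, …)`-adic odometer and the `n`-adic odometer. -/
theorem odometer_mixed_mul_conj (m n s : ℕ) (hm : 2 ≤ m) (hn : 2 ≤ n)
    (hs : 2 ≤ s) (hmn : Nat.Coprime m n) (hsm : Nat.Coprime s m)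
    (hsn : Nat.Coprime s n) :
    ∃ h : OdometerSpace (fun k => if k = 0 then s else m * n) ≃ₜ
        (OdometerSpace (fun k => if k = 0 then s else m) ×
          OdometerSpace (fun _ => n)),
      ∀ z, h (odometerAddOne (fun k => if k = 0 then s else m * n) z) =
        (odometerAddOne (fun k => if k = 0 then s else m) (h z).1,
          odometerAddOne (fun _ => n) (h z).2) := by
  refine ⟨OdometerSpace.prodHomeomorph (fun k => ?_) (fun k => ?_) (fun k => ?_) (fun k => ?_),
    fun z => Prod.ext (OdometerSpace.map_odometerAddOne _ z)
      (OdometerSpace.map_odometerAddOne _ z)⟩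
  all_goals simp only [odProd_ite_zero, odProd_const]
  · exact Nat.Coprime.mul_left (hsn.pow_right _) (hmn.pow _ _)
  · exact ⟨n, by ring⟩
  · exact ⟨m * n ^ (k + 1), by ring⟩
  · exact ⟨s * m ^ (k + 1), by ring⟩
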